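/- Let F : ℝ^d × ℝ → ℝ be continuous and nondecreasing in its second variable, and let μ, μ' be compactly supported Borel probability measures on ℝ^d. Then for every ε > 0, ∫_{ℝ^d} (F^ε(x, μ) − F^ε(x, μ')) dμ(x) − ∫_{ℝ^d} (F^ε(x, μ) − F^ε(x, μ')) dμ'(x) ≥ 0. -/

import Mathlib

open MeasureTheory

noncomputable section

/-- Euclidean space `ℝ^d`. -/
abbrev Euc (d : ℕ) := EuclideanSpace ℝ (Fin d)

/-- The scaled mollifier `ξ^ε(x) = ε^{-d} ξ(x/ε)`. -/
def sMoll (d : ℕ) (ξ : Euc d → ℝ) (ε : ℝ) : Euc d → ℝ :=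
  fun x => (ε ^ d)⁻¹ * ξ (ε⁻¹ • x)

/-- Convolution `(ξ^ε ⋆ μ)(y) = ∫ ξ^ε(y−z) dμ(z)` of the scaled mollifier with a measure. -/
def mollMeas (d : ℕ) (ξ : Euc d → ℝ) (ε : ℝ) (μ : Measure (Euc d)) : Euc d → ℝ :=
  fun y => ∫ z, sMoll d ξ ε (y - z) ∂μ

/-- The mollified coupling `F^ε(x, μ) = ∫ ξ^ε(x−y) F(y, (ξ^ε ⋆ μ)(y)) dy`. -/
def FepsMeas (d : ℕ) (ξ : Euc d → ℝ) (ε : ℝ) (F : Euc d → ℝ → ℝ)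
    (μ : Measure (Euc d)) : Euc d → ℝ :=
  fun x => ∫ y, sMoll d ξ ε (x - y) * F y (mollMeas d ξ ε μ y)

section Mollifier

variable {d : ℕ} {ξ : Euc d → ℝ} {ε : ℝ}

lemma continuous_sMoll (hξ : Continuous ξ) : Continuous (sMoll d ξ ε) := by
  unfold sMoll
  fun_prop

lemma hasCompactSupport_sMoll (hξ : HasCompactSupport ξ) (hε : 0 < ε) :
    HasCompactSupport (sMoll d ξ ε) :=
  (hξ.comp_smul (inv_ne_zero hε.ne')).mul_left (f := fun _ => (ε ^ d)⁻¹)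

lemma sMoll_sub_comm (hξ : ∀ x, ξ (-x) = ξ x) (x y : Euc d) :
    sMoll d ξ ε (x - y) = sMoll d ξ ε (y - x) := by
  unfold sMoll
  rw [← neg_sub y x, smul_neg, hξ]

lemma continuous_mollMeas (hξ : Continuous ξ) (hξs : HasCompactSupport ξ) (hε : 0 < ε)
    (μ : Measure (Euc d)) [IsFiniteMeasure μ] : Continuous (mollMeas d ξ ε μ) := by
  have hφ : Continuous (sMoll d ξ ε) := continuous_sMoll hξ
  obtain ⟨C, hC⟩ := (hasCompactSupport_sMoll hξs hε).exists_bound_of_continuous hφ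
  refine continuous_of_dominated (bound := fun _ => C) (fun y => ?_)
    (fun y => Filter.Eventually.of_forall fun z => hC _) (integrable_const C)
    (Filter.Eventually.of_forall fun z => by fun_prop)
  exact Continuous.aestronglyMeasurable (by fun_prop)

end Mollifier

section Convolution

variable {E : Type*} [NormedAddCommGroup E] [MeasurableSpace E] [BorelSpace E]

lemma integrable_sub_mul (m : Measure E) [IsFiniteMeasureOnCompacts m]
    {φ g : E → ℝ} (hφ : Continuous φ)
    (hφs : HasCompactSupport φ) (hg : Continuous g) (x : E) :
    Integrable (fun y => φ (x - y) * g y) m := by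
  refine Continuous.integrable_of_hasCompactSupport (by fun_prop) ?_
  have h : HasCompactSupport fun y => φ (x - y) :=
    hφs.comp_homeomorph (Homeomorph.subLeft x)
  exact h.mul_right

variable [SecondCountableTopology E]

lemma integrable_prod_sub_mul (m : Measure E) [SFinite m] [IsFiniteMeasureOnCompacts m]
    {φ g : E → ℝ} (hφ : Continuous φ) (hφs : HasCompactSupport φ) (hg : Continuous g)
    (ν : Measure E) [IsFiniteMeasure ν] (hν : ∃ K : Set E, IsCompact K ∧ ν Kᶜ = 0) :
    Integrable (fun p : E × E => φ (p.1 - p.2) * g p.2) (ν.prod m) := by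
  obtain ⟨K, hK, hνK⟩ := hν
  have hL : IsCompact (K ×ˢ ((fun p : E × E => p.1 - p.2) '' K ×ˢ tsupport φ)) :=
    hK.prod ((hK.prod hφs).image continuous_sub)
  have hcont : Continuous fun p : E × E => φ (p.1 - p.2) * g p.2 := by fun_prop
  have hint := hcont.continuousOn.integrableOn_compact (μ := ν.prod m) hL
  refine hint.integrable_of_ae_notMem_eq_zero ?_
  have hmem : ∀ᵐ x ∂ν, x ∈ K := hνK
  filter_upwards [Measure.quasiMeasurePreserving_fst.ae hmem] with p hp hpL
  have h : φ (p.1 - p.2) = 0 := by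
    by_contra h
    exact hpL ⟨hp, (p.1, p.1 - p.2), ⟨hp, subset_tsupport φ h⟩, sub_sub_cancel _ _⟩
  rw [h, zero_mul]

lemma integrable_integral_mul (m : Measure E) [SFinite m] [IsFiniteMeasureOnCompacts m]
    {φ g : E → ℝ} (hφ : Continuous φ) (hφs : HasCompactSupport φ) (hg : Continuous g)
    (ν : Measure E) [IsFiniteMeasure ν] (hν : ∃ K : Set E, IsCompact K ∧ ν Kᶜ = 0) :
    Integrable (fun y => (∫ x, φ (x - y) ∂ν) * g y) m := by
  simpa only [integral_mul_const] using
    (integrable_prod_sub_mul m hφ hφs hg ν hν).integral_prod_right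

lemma integral_integral_sub_mul (m : Measure E) [SFinite m] [IsFiniteMeasureOnCompacts m]
    {φ g : E → ℝ} (hφ : Continuous φ) (hφs : HasCompactSupport φ) (hg : Continuous g)
    (ν : Measure E) [IsFiniteMeasure ν] (hν : ∃ K : Set E, IsCompact K ∧ ν Kᶜ = 0) :
    ∫ x, ∫ y, φ (x - y) * g y ∂m ∂ν = ∫ y, (∫ x, φ (x - y) ∂ν) * g y ∂m := by
  rw [integral_integral_swap (integrable_prod_sub_mul m hφ hφs hg ν hν)]
  simp only [integral_mul_const]

end Convolution

/-- Monotonicity of the mollified coupling $F^ε$. -/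
theorem statement0 (d : ℕ) (hd : 1 ≤ d) (ξ : Euc d → ℝ)
    (hξ_smooth : ContDiff ℝ (⊤ : ℕ∞) ξ) (hξ_nonneg : ∀ x, 0 ≤ ξ x)
    (hξ_even : ∀ x, ξ (-x) = ξ x) (hξ_supp : HasCompactSupport ξ)
    (hξ_int : ∫ x, ξ x = 1)
    (F : Euc d → ℝ → ℝ)
    (hF_cont : Continuous fun p : Euc d × ℝ => F p.1 p.2)
    (hF_mono : ∀ x : Euc d, Monotone (F x))
    (μ μ' : Measure (Euc d)) [IsProbabilityMeasure μ] [IsProbabilityMeasure μ']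
    (hμ_supp : ∃ K : Set (Euc d), IsCompact K ∧ μ Kᶜ = 0)
    (hμ'_supp : ∃ K : Set (Euc d), IsCompact K ∧ μ' Kᶜ = 0)
    (ε : ℝ) (hε : 0 < ε) :
    0 ≤ (∫ x, (FepsMeas d ξ ε F μ x - FepsMeas d ξ ε F μ' x) ∂μ)
        - ∫ x, (FepsMeas d ξ ε F μ x - FepsMeas d ξ ε F μ' x) ∂μ' := by
  have hξ : Continuous ξ := hξ_smooth.continuous
  have hφ : Continuous (sMoll d ξ ε) := continuous_sMoll hξ
  have hφs := hasCompactSupport_sMoll hξ_supp hε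
  have hcont (ν : Measure (Euc d)) [IsFiniteMeasure ν] :
      Continuous fun y => F y (mollMeas d ξ ε ν y) :=
    hF_cont.comp (continuous_id.prodMk (continuous_mollMeas hξ hξ_supp hε ν))
  let g : Euc d → ℝ := fun y => F y (mollMeas d ξ ε μ y) - F y (mollMeas d ξ ε μ' y)
  have hg : Continuous g := (hcont μ).sub (hcont μ')
  have hsub (x : Euc d) : FepsMeas d ξ ε F μ x - FepsMeas d ξ ε F μ' x
      = ∫ y, sMoll d ξ ε (x - y) * g y := by
    simp only [FepsMeas, g, mul_sub]
    exact (integral_sub (integrable_sub_mul volume hφ hφs (hcont μ) x)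
      (integrable_sub_mul volume hφ hφs (hcont μ') x)).symm
  have hmoll (ν : Measure (Euc d)) (y : Euc d) :
      ∫ x, sMoll d ξ ε (x - y) ∂ν = mollMeas d ξ ε ν y :=
    integral_congr_ae (Filter.Eventually.of_forall fun x => sMoll_sub_comm hξ_even x y)
  simp only [hsub]
  rw [integral_integral_sub_mul volume hφ hφs hg μ hμ_supp,
    integral_integral_sub_mul volume hφ hφs hg μ' hμ'_supp,
    ← integral_sub (integrable_integral_mul volume hφ hφs hg μ hμ_supp)
      (integrable_integral_mul volume hφ hφs hg μ' hμ'_supp)]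
  refine integral_nonneg fun y => ?_
  simp only [hmoll, g, ← sub_mul, Pi.zero_apply]
  rcases le_total (mollMeas d ξ ε μ y) (mollMeas d ξ ε μ' y) with h | h
  · exact mul_nonneg_of_nonpos_of_nonpos (sub_nonpos.2 h) (sub_nonpos.2 (hF_mono y h))
  · exact mul_nonneg (sub_nonneg.2 h) (sub_nonneg.2 (hF_mono y h))
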